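/- Let G be a finite simple graph on vertex set V with adjacency matrix A = (a_{ij}) and degrees d_i = Σ_j a_{ij}. Suppose κ ∈ ℝ and v : V × V → ℝ satisfy the non-backtracking eigen-equation: for every ordered pair (i,j) with a_{ij} = 1, κ·v(i,j) = Σ_{k : a_{jk}=1, k ≠ i} v(j,k). Define the outgoing centrality x_i = Σ_{j : a_{ij}=1} v(i,j) and the incoming centrality y_i = Σ_{j : a_{ij}=1} v(j,i). Then for every vertex i, κ·y_i = (d_i − 1)·x_i. -/

import Mathlib

open Finset

/-- For a finite simple graph with adjacency matrix `A` (0/1 entries, symmetric, zero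
diagonal) and a pair `(κ, v)` satisfying the non-backtracking eigen-equation, the
outgoing centrality `x i = ∑_{j ∈ N_i} v i j` and the incoming centrality
`y i = ∑_{j ∈ N_i} v j i` satisfy `κ * y i = (d i - 1) * x i`. -/
theorem nbc_incoming_outgoing (N : ℕ) (A : Fin N → Fin N → ℝ)
    (hA01 : ∀ i j, A i j = 0 ∨ A i j = 1)
    (hSymm : ∀ i j, A i j = A j i)
    (hDiag : ∀ i, A i i = 0)
    (κ : ℝ) (v : Fin N → Fin N → ℝ)
    (heig : ∀ i j, A i j = 1 →
      κ * v i j = ∑ k, if A j k = 1 ∧ k ≠ i then v j k else 0)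
    (d x y : Fin N → ℝ)
    (hd : ∀ i, d i = ∑ j, A i j)
    (hx : ∀ i, x i = ∑ j, if A i j = 1 then v i j else 0)
    (hy : ∀ i, y i = ∑ j, if A i j = 1 then v j i else 0) :
    ∀ i, κ * y i = (d i - 1) * x i := by
  intro i
  have key : ∀ j, κ * (if A i j = 1 then v j i else 0) =
      A i j * x i - (if A i j = 1 then v i j else 0) := by
    intro j
    rcases hA01 i j with h | h
    · simp [h]
    · have hsplit : x i = v i j + ∑ k, if A i k = 1 ∧ k ≠ j then v i k else 0 := by
        rw [hx, ← Finset.add_sum_erase _ _ (Finset.mem_univ j), if_pos h,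
          ← Finset.add_sum_erase _ (fun k => if A i k = 1 ∧ k ≠ j then v i k else 0)
            (Finset.mem_univ j)]
        simp only [ne_eq, not_true_eq_false, and_false, if_false, zero_add]
        congr 1
        refine Finset.sum_congr rfl fun k hk => ?_
        simp [Finset.ne_of_mem_erase hk]
      rw [if_pos h, if_pos h, heig j i (hSymm i j ▸ h), hsplit, h]
      ring
  rw [hy, Finset.mul_sum, Finset.sum_congr rfl fun j _ => key j, Finset.sum_sub_distrib,
    ← Finset.sum_mul, ← hd, ← hx]
  ring
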